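/- arXiv:1405.7244 — 3 statements merged into one kernel-verified Lean document; each statement's English description precedes it below -/
import Mathlib

section
/- Let Y ~ N(0,Σ) be a p-dimensional Gaussian vector with covariance matrix Σ and let δ ≥ 0. Then E|(YᵀY − f₁)/f|^{2+δ} ≤ c_δ^{2+δ}, where c_δ = (1+δ)^{1/2}‖ξ²−1‖_{2+δ} and ξ ~ N(0,1). -/
open MeasureTheory ProbabilityTheory Filter Asymptotics

noncomputable section

/-- `c_δ = (1+δ)^{1/2} ‖ξ²-1‖_{2+δ}` where `ξ ~ N(0,1)`. -/
def cdel (δ : ℝ) : ℝ :=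
  Real.sqrt (1 + δ) * (∫ x, |x ^ 2 - 1| ^ (2 + δ) ∂(gaussianReal 0 1)) ^ (2 + δ)⁻¹

/-- A random vector `Y` is centered Gaussian with covariance matrix `S` iff every linear
functional of it is a centered real Gaussian with the corresponding variance. -/
def IsGaussianVec {Ω : Type*} [MeasureSpace Ω] {p : ℕ}
    (Y : Ω → Fin p → ℝ) (S : Matrix (Fin p) (Fin p) ℝ) : Prop :=
  ∀ u : Fin p → ℝ,
    Measure.map (fun ω => ∑ j, u j * Y ω j) volume
      = gaussianReal 0 (Real.toNNReal (∑ j, ∑ k, u j * S j k * u k))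

theorem bonami_two_point_unit {q t : ℝ} (hq : 2 ≤ q) (ht0 : 0 ≤ t) (ht1 : t ≤ 1) :
    ((1 + t) ^ q + (1 - t) ^ q) / 2 ≤ (1 + (q - 1) * t ^ 2) ^ (q / 2) := by
  have hq0 : 0 < q := by linarith
  set φ : ℝ → ℝ := fun t => ((1 + t) ^ q + (1 - t) ^ q) / 2 with hφ
  set φ' : ℝ → ℝ := fun t => q * ((1 + t) ^ (q - 1) - (1 - t) ^ (q - 1)) / 2 with hφ'
  have d1 : ∀ t, HasDerivAt φ (φ' t) t := by
    intro t
    have h1 := ((hasDerivAt_id t).const_add 1).rpow_const (p := q) (Or.inr (by linarith))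
    have h2 := ((hasDerivAt_id t).const_sub 1).rpow_const (p := q) (Or.inr (by linarith))
    refine ((h1.add h2).div_const 2).congr_deriv ?_
    simp only [hφ', id]
    ring
  have d2 : ∀ t, HasDerivAt φ'
      (q * (q - 1) * (((1 + t) ^ (q - 2) + (1 - t) ^ (q - 2)) / 2)) t := by
    intro t
    have h1 := ((hasDerivAt_id t).const_add 1).rpow_const (p := q - 1) (Or.inr (by linarith))
    have h2 := ((hasDerivAt_id t).const_sub 1).rpow_const (p := q - 1) (Or.inr (by linarith))
    refine (((h1.sub h2).const_mul q).div_const 2).congr_deriv ?_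
    simp only [id, show q - 1 - 1 = q - 2 by ring]
    ring
  have φ'_nonneg : ∀ t, 0 ≤ t → t ≤ 1 → 0 ≤ φ' t := by
    intro t h0 h1
    have : (1 - t) ^ (q - 1) ≤ (1 + t) ^ (q - 1) :=
      Real.rpow_le_rpow (by linarith) (by linarith) (by linarith)
    simp only [hφ']
    have : 0 ≤ q * ((1 + t) ^ (q - 1) - (1 - t) ^ (q - 1)) :=
      mul_nonneg hq0.le (by linarith)
    linarith
  have φ_pos : ∀ t, 0 ≤ t → t ≤ 1 → 0 < φ t := by
    intro t h0 h1
    have h2 : 0 < (1 + t) ^ q := Real.rpow_pos_of_pos (by linarith) _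
    have h3 : 0 ≤ (1 - t) ^ q := Real.rpow_nonneg (by linarith) _
    simp only [hφ]
    linarith
  have φ_mono : MonotoneOn φ (Set.Icc 0 1) := by
    refine monotoneOn_of_deriv_nonneg (convex_Icc 0 1)
      (fun t _ => (d1 t).continuousAt.continuousWithinAt)
      (fun t _ => (d1 t).differentiableAt.differentiableWithinAt) ?_
    intro t ht
    rw [interior_Icc] at ht
    rw [(d1 t).deriv]
    exact φ'_nonneg t ht.1.le ht.2.le
  have φ'_le : ∀ t, 0 < t → t ≤ 1 → φ' t ≤ q * (q - 1) * t * φ t ^ (1 - 2 / q) := by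
    intro t h0 h1
    obtain ⟨s, hs, hst⟩ := exists_hasDerivAt_eq_slope φ' _ h0
      (fun t _ => (d2 t).continuousAt.continuousWithinAt) (fun t _ => d2 t)
    have hφ'0 : φ' 0 = 0 := by simp [hφ']
    rw [hφ'0, sub_zero, sub_zero, eq_div_iff h0.ne'] at hst
    have hr0 : 0 ≤ 1 - 2 / q := by
      rw [sub_nonneg, div_le_one hq0]; exact hq
    have hr1 : 1 - 2 / q ≤ 1 := by
      have : 0 ≤ 2 / q := by positivity
      linarith
    have hm : ((1 + s) ^ (q - 2) + (1 - s) ^ (q - 2)) / 2 ≤ φ s ^ (1 - 2 / q) := by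
      have hp : 0 ≤ (1 + s) := by linarith [hs.1]
      have hn : 0 ≤ (1 - s) := by linarith [hs.2]
      have key := (Real.concaveOn_rpow hr0 hr1).2
        (show (1 + s) ^ q ∈ Set.Ici 0 from Real.rpow_nonneg hp _)
        (show (1 - s) ^ q ∈ Set.Ici 0 from Real.rpow_nonneg hn _)
        (show (0 : ℝ) ≤ 1 / 2 by norm_num) (show (0 : ℝ) ≤ 1 / 2 by norm_num) (by norm_num)
      have e : q * (1 - 2 / q) = q - 2 := by field_simp
      simp only [smul_eq_mul, ← Real.rpow_mul hp, ← Real.rpow_mul hn, e] at key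
      have e2 : φ s = 1 / 2 * (1 + s) ^ q + 1 / 2 * (1 - s) ^ q := by simp only [hφ]; ring
      rw [e2]
      linarith
    have hmono : φ s ^ (1 - 2 / q) ≤ φ t ^ (1 - 2 / q) :=
      Real.rpow_le_rpow (φ_pos s hs.1.le (hs.2.le.trans h1)).le
        (φ_mono ⟨hs.1.le, hs.2.le.trans h1⟩ ⟨h0.le, h1⟩ hs.2.le) hr0
    rw [← hst]
    have hc : 0 ≤ q * (q - 1) * t := by
      have : 0 ≤ q - 1 := by linarith
      positivity
    nlinarith [mul_le_mul_of_nonneg_left (hm.trans hmono) hc]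
  have g_anti : AntitoneOn (fun t => φ t ^ (2 / q) - (q - 1) * t ^ 2) (Set.Icc 0 1) := by
    have dg : ∀ t ∈ Set.Icc (0 : ℝ) 1, HasDerivAt (fun t => φ t ^ (2 / q) - (q - 1) * t ^ 2)
        (φ' t * (2 / q) * φ t ^ (2 / q - 1) - (q - 1) * (2 * t)) t := by
      intro t ht
      have h1 := (d1 t).rpow_const (p := 2 / q) (Or.inl (φ_pos t ht.1 ht.2).ne')
      have h2 := (hasDerivAt_pow 2 t).const_mul (q - 1)
      exact (h1.sub h2).congr_deriv (by simp)
    refine antitoneOn_of_deriv_nonpos (convex_Icc 0 1)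
      (fun t ht => (dg t ht).continuousAt.continuousWithinAt)
      (fun t ht => (dg t (interior_subset ht)).differentiableAt.differentiableWithinAt) ?_
    intro t ht
    rw [(dg t (interior_subset ht)).deriv]
    rw [interior_Icc] at ht
    have hpos := φ_pos t ht.1.le ht.2.le
    have h1 := φ'_le t ht.1 ht.2.le
    have h2 : φ t ^ (1 - 2 / q) * φ t ^ (2 / q - 1) = 1 := by
      rw [← Real.rpow_add hpos]; simp
    have h3 : 0 ≤ (2 / q) * φ t ^ (2 / q - 1) :=
      mul_nonneg (by positivity) (Real.rpow_nonneg hpos.le _)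
    have h4 := mul_le_mul_of_nonneg_right h1 h3
    have h5 : q * (q - 1) * t * φ t ^ (1 - 2 / q) * (2 / q * φ t ^ (2 / q - 1))
        = (q - 1) * (2 * t) := by
      calc _ = (q * (2 / q)) * (q - 1) * t * (φ t ^ (1 - 2 / q) * φ t ^ (2 / q - 1)) := by ring
        _ = _ := by rw [h2, mul_div_cancel₀ _ hq0.ne']; ring
    linarith
  have hfin := g_anti (show (0 : ℝ) ∈ Set.Icc 0 1 by simp) ⟨ht0, ht1⟩ ht0
  have hφ0 : φ 0 = 1 := by simp [hφ]
  simp only [hφ0, Real.one_rpow] at hfin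
  have h6 : φ t ^ (2 / q) ≤ 1 + (q - 1) * t ^ 2 := by linarith
  have h7 := Real.rpow_le_rpow (Real.rpow_nonneg (φ_pos t ht0 ht1).le _) h6
    (show 0 ≤ q / 2 by positivity)
  rwa [← Real.rpow_mul (φ_pos t ht0 ht1).le, div_mul_div_cancel₀ hq0.ne', div_self two_ne_zero,
    Real.rpow_one] at h7

/-- Bonami's two-point inequality. -/
theorem bonami_two_point {q : ℝ} (hq : 2 ≤ q) (a b : ℝ) :
    (|a + b| ^ q + |a - b| ^ q) / 2 ≤ (a ^ 2 + (q - 1) * b ^ 2) ^ (q / 2) := by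
  have hq0 : 0 < q := by linarith
  have ordered : ∀ {a b : ℝ}, 0 ≤ b → b ≤ a →
      (|a + b| ^ q + |a - b| ^ q) / 2 ≤ (a ^ 2 + (q - 1) * b ^ 2) ^ (q / 2) := by
    intro a b hb hba
    rcases hb.eq_or_lt with rfl | hb
    · have : (a ^ 2) ^ (q / 2) = |a| ^ q := by
        rw [← sq_abs, ← Real.rpow_natCast_mul (abs_nonneg a)]
        congr 1; push_cast; ring
      simp [this]
    have ha : 0 < a := hb.trans_le hba
    have h := bonami_two_point_unit hq (div_nonneg hb.le ha.le) ((div_le_one ha).2 hba)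
    have e1 : |a + b| = a * (1 + b / a) := by
      rw [abs_of_pos (by linarith)]; field_simp
    have e2 : |a - b| = a * (1 - b / a) := by
      rw [abs_of_nonneg (by linarith)]; field_simp
    have n2 : 0 ≤ 1 - b / a := by rw [sub_nonneg, div_le_one ha]; exact hba
    have e3 : a ^ 2 + (q - 1) * b ^ 2 = a ^ 2 * (1 + (q - 1) * (b / a) ^ 2) := by field_simp
    have n3 : 0 ≤ 1 + (q - 1) * (b / a) ^ 2 := by
      have : 0 ≤ q - 1 := by linarith
      positivity
    have e4 : (a ^ 2) ^ (q / 2) = a ^ q := by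
      rw [← Real.rpow_natCast_mul ha.le]
      congr 1; push_cast; ring
    rw [e1, e2, e3, Real.mul_rpow ha.le (by positivity), Real.mul_rpow ha.le n2,
      Real.mul_rpow (by positivity) n3, e4]
    nlinarith [mul_le_mul_of_nonneg_left h (Real.rpow_nonneg ha.le q)]
  have nonneg : ∀ {a b : ℝ}, 0 ≤ a → 0 ≤ b →
      (|a + b| ^ q + |a - b| ^ q) / 2 ≤ (a ^ 2 + (q - 1) * b ^ 2) ^ (q / 2) := by
    intro a b ha hb
    rcases le_total b a with h | h
    · exact ordered hb h
    · rw [add_comm a b, abs_sub_comm]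
      refine (ordered ha h).trans (Real.rpow_le_rpow ?_ ?_ (by positivity))
      · have : 0 ≤ q - 1 := by linarith
        positivity
      · nlinarith [mul_nonneg (show 0 ≤ q - 2 by linarith) (sub_nonneg.2 (pow_le_pow_left₀ ha h 2))]
  have h := nonneg (abs_nonneg a) (abs_nonneg b)
  rw [sq_abs, sq_abs] at h
  refine le_trans (le_of_eq ?_) h
  rcases le_total 0 a with ha | ha <;> rcases le_total 0 b with hb | hb <;>
    simp only [abs_of_nonneg, abs_of_nonpos, ha, hb]
  · rw [← sub_eq_add_neg, sub_neg_eq_add, add_comm]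
  · rw [show -a + b = -(a - b) by ring, show -a - b = -(a + b) by ring, abs_neg, abs_neg, add_comm]
  · rw [show -a + -b = -(a + b) by ring, show -a - -b = -(a - b) by ring, abs_neg, abs_neg]

theorem lpNorm_ofReal_eq {Ω : Type*} {m : MeasurableSpace Ω} {μ : Measure Ω} {q : ℝ} (hq : 0 < q)
    {f : Ω → ℝ} (hf : AEStronglyMeasurable f μ) :
    lpNorm f (ENNReal.ofReal q) μ = (∫ ω, |f ω| ^ q ∂μ) ^ q⁻¹ := by
  rw [lpNorm_eq_integral_norm_rpow_toReal (by simpa using hq) (by simp) hf,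
    ENNReal.toReal_ofReal hq.le]
  simp only [Real.norm_eq_abs]

theorem memLp_ofReal_iff {Ω : Type*} {m : MeasurableSpace Ω} {μ : Measure Ω} {q : ℝ} (hq : 0 < q)
    {f : Ω → ℝ} (hf : AEStronglyMeasurable f μ) :
    MemLp f (ENNReal.ofReal q) μ ↔ Integrable (fun ω => |f ω| ^ q) μ := by
  rw [← integrable_norm_rpow_iff hf (by simpa using hq) (by simp), ENNReal.toReal_ofReal hq.le]
  simp only [Real.norm_eq_abs]

theorem abs_sq_rpow_half (x q : ℝ) : |x ^ 2| ^ (q / 2) = |x| ^ q := by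
  rw [abs_pow, ← Real.rpow_natCast_mul (abs_nonneg x)]
  congr 1
  push_cast
  ring

theorem memLp_sq_half {Ω : Type*} {m : MeasurableSpace Ω} {μ : Measure Ω} {q : ℝ} (hq : 0 < q)
    {f : Ω → ℝ} (hf : MemLp f (ENNReal.ofReal q) μ) :
    MemLp (fun ω => f ω ^ 2) (ENNReal.ofReal (q / 2)) μ := by
  have hf2 : AEStronglyMeasurable (fun ω => f ω ^ 2) μ := hf.1.pow 2
  rw [memLp_ofReal_iff (by positivity) hf2]
  simpa only [abs_sq_rpow_half] using (memLp_ofReal_iff hq hf.1).1 hf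

theorem lpNorm_sq_half {Ω : Type*} {m : MeasurableSpace Ω} {μ : Measure Ω} {q : ℝ} (hq : 0 < q)
    {f : Ω → ℝ} (hf : AEStronglyMeasurable f μ) :
    lpNorm (fun ω => f ω ^ 2) (ENNReal.ofReal (q / 2)) μ = lpNorm f (ENNReal.ofReal q) μ ^ 2 := by
  have hf2 : AEStronglyMeasurable (fun ω => f ω ^ 2) μ := hf.pow 2
  rw [lpNorm_ofReal_eq (by positivity) hf2, lpNorm_ofReal_eq hq hf,
    ← Real.rpow_mul_natCast (integral_nonneg fun ω => Real.rpow_nonneg (abs_nonneg _) _)]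
  simp only [abs_sq_rpow_half]
  congr 1
  field_simp
  norm_num

/-- The 2-uniform smoothness of `L^q` for `q ≥ 2`, with the optimal constant. -/
theorem lpNorm_smoothness {Ω : Type*} {m : MeasurableSpace Ω} {μ : Measure Ω} {q : ℝ} (hq : 2 ≤ q)
    {f g : Ω → ℝ} (hf : MemLp f (ENNReal.ofReal q) μ) (hg : MemLp g (ENNReal.ofReal q) μ) :
    lpNorm (f + g) (ENNReal.ofReal q) μ ^ 2 + lpNorm (f - g) (ENNReal.ofReal q) μ ^ 2 ≤
      2 * lpNorm f (ENNReal.ofReal q) μ ^ 2 + 2 * (q - 1) * lpNorm g (ENNReal.ofReal q) μ ^ 2 := by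
  have hq0 : 0 < q := by linarith
  have hq1 : 0 ≤ q - 1 := by linarith
  have hadd := hf.add hg
  have hsub := hf.sub hg
  have sq_eq : ∀ {u : Ω → ℝ}, AEStronglyMeasurable u μ →
      lpNorm u (ENNReal.ofReal q) μ ^ 2 = (∫ ω, |u ω| ^ q ∂μ) ^ (2 / q) := by
    intro u hu
    rw [lpNorm_ofReal_eq hq0 hu,
      ← Real.rpow_mul_natCast (integral_nonneg fun ω => Real.rpow_nonneg (abs_nonneg _) _)]
    congr 1
    push_cast
    ring
  have hf2 := memLp_sq_half hq0 hf
  have hg2 := (memLp_sq_half hq0 hg).const_mul (q - 1)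
  have hh := hf2.add hg2
  have hhi := (memLp_ofReal_iff (by positivity) hh.1).1 hh
  have hA := (memLp_ofReal_iff hq0 hadd.1).1 hadd
  have hB := (memLp_ofReal_iff hq0 hsub.1).1 hsub
  have tri := lpNorm_add_le (g := fun ω => (q - 1) * g ω ^ 2) hf2
    (by rw [← ENNReal.ofReal_one]; exact ENNReal.ofReal_le_ofReal (by linarith))
  have hg2n : lpNorm (fun ω => (q - 1) * g ω ^ 2) (ENNReal.ofReal (q / 2)) μ
      = (q - 1) * lpNorm g (ENNReal.ofReal q) μ ^ 2 := by
    rw [← lpNorm_sq_half hq0 hg.1]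
    have := lpNorm_const_smul (p := ENNReal.ofReal (q / 2)) (q - 1) (fun ω => g ω ^ 2) μ
    simpa [abs_of_nonneg hq1, Pi.smul_def] using this
  rw [lpNorm_sq_half hq0 hf.1, hg2n, lpNorm_ofReal_eq (by positivity) hh.1] at tri
  have hAn : 0 ≤ ∫ ω, |(f + g) ω| ^ q ∂μ :=
    integral_nonneg fun ω => Real.rpow_nonneg (abs_nonneg _) _
  have hBn : 0 ≤ ∫ ω, |(f - g) ω| ^ q ∂μ :=
    integral_nonneg fun ω => Real.rpow_nonneg (abs_nonneg _) _
  have conc := (Real.concaveOn_rpow (p := 2 / q) (by positivity) ((div_le_one hq0).2 hq)).2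
    (show _ ∈ Set.Ici 0 from hAn) (show _ ∈ Set.Ici 0 from hBn)
    (show (0 : ℝ) ≤ 1 / 2 by norm_num) (show (0 : ℝ) ≤ 1 / 2 by norm_num) (by norm_num)
  simp only [smul_eq_mul] at conc
  have mono : 1 / 2 * ∫ ω, |(f + g) ω| ^ q ∂μ + 1 / 2 * ∫ ω, |(f - g) ω| ^ q ∂μ
      ≤ ∫ ω, |f ω ^ 2 + (q - 1) * g ω ^ 2| ^ (q / 2) ∂μ := by
    rw [← integral_const_mul, ← integral_const_mul,
      ← integral_add (hA.const_mul _) (hB.const_mul _)]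
    refine integral_mono ((hA.const_mul _).add (hB.const_mul _)) hhi fun ω => ?_
    have h := bonami_two_point hq (f ω) (g ω)
    rw [← abs_of_nonneg (show 0 ≤ f ω ^ 2 + (q - 1) * g ω ^ 2 by positivity)] at h
    simp only [Pi.add_apply, Pi.sub_apply]
    linarith
  have mono' := Real.rpow_le_rpow (by positivity) mono (show 0 ≤ 2 / q by positivity)
  rw [sq_eq hadd.1, sq_eq hsub.1]
  rw [inv_div] at tri
  simp only [Pi.add_apply] at tri
  linarith

theorem lpNorm_le_lpNorm_sub_of_indepFun {Ω : Type*} {m : MeasurableSpace Ω} {μ : Measure Ω}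
    [IsProbabilityMeasure μ] {p : ENNReal} (hp : 1 ≤ p) {X Y : Ω → ℝ}
    (hXm : Measurable X) (hYm : Measurable Y)
    (hX : MemLp X p μ) (hY : MemLp Y p μ) (hXY : IndepFun X Y μ) (hY0 : ∫ ω, Y ω ∂μ = 0) :
    lpNorm X p μ ≤ lpNorm (X - Y) p μ := by
  have h := (hX.sub hY).lpNorm_condExp_le_lpNorm (m := MeasurableSpace.comap X inferInstance) hp
  have hXsm : StronglyMeasurable[MeasurableSpace.comap X inferInstance] X :=
    (comap_measurable X).stronglyMeasurable
  have hYsm : StronglyMeasurable[MeasurableSpace.comap Y inferInstance] Y :=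
    (comap_measurable Y).stronglyMeasurable
  have hind := condExp_indep_eq hYm.comap_le hXm.comap_le hYsm hXY.symm
  have hsub := condExp_sub (hX.integrable hp) (hY.integrable hp)
    (MeasurableSpace.comap X inferInstance)
  rw [condExp_of_stronglyMeasurable hXm.comap_le hXsm (hX.integrable hp)] at hsub
  have hae : μ[X - Y | MeasurableSpace.comap X inferInstance] =ᵐ[μ] X := by
    filter_upwards [hsub, hind] with ω h1 h2
    rw [h1, Pi.sub_apply, h2, hY0, sub_zero]
  rwa [← toReal_eLpNorm (integrable_condExp.1), eLpNorm_congr_ae hae, toReal_eLpNorm hX.1] at h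

/-- The increment bound for a sequence with bounded second differences. -/
theorem le_add_of_second_difference_le {a : ℕ → ℝ} {c : ℝ} (h0 : a 1 ≤ a 0 + 2 * c)
    (h : ∀ k, a (k + 2) + a k ≤ 2 * a (k + 1) + 2 * c) (n : ℕ) :
    a n ≤ a 0 + c * (n * (n + 1)) := by
  have step : ∀ k : ℕ, a (k + 1) ≤ a k + 2 * c * (k + 1) := by
    intro k
    induction k with
    | zero => simpa using h0
    | succ k ih => push_cast; linarith [h k]
  induction n with
  | zero => simp
  | succ n ih => push_cast; linarith [step n]

theorem lpNorm_add_sq_le_of_indepFun {Ω : Type*} {m : MeasurableSpace Ω} {μ : Measure Ω}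
    [IsProbabilityMeasure μ] {q : ℝ} (hq : 2 ≤ q) {X Y : Ω → ℝ}
    (hXm : Measurable X) (hYm : Measurable Y)
    (hX : MemLp X (ENNReal.ofReal q) μ) (hY : MemLp Y (ENNReal.ofReal q) μ)
    (hXY : IndepFun X Y μ) (hY0 : ∫ ω, Y ω ∂μ = 0) :
    lpNorm (X + Y) (ENNReal.ofReal q) μ ^ 2 ≤
      lpNorm X (ENNReal.ofReal q) μ ^ 2 + (q - 1) * lpNorm Y (ENNReal.ofReal q) μ ^ 2 := by
  set C := (q - 1) * lpNorm Y (ENNReal.ofReal q) μ ^ 2 with hC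
  have hp : 1 ≤ ENNReal.ofReal q := by
    rw [← ENNReal.ofReal_one]; exact ENNReal.ofReal_le_ofReal (by linarith)
  have bound : ∀ n : ℕ, lpNorm (X + Y) (ENNReal.ofReal q) μ ^ 2 ≤
      lpNorm X (ENNReal.ofReal q) μ ^ 2 + (C + C * (1 / ((n : ℝ) + 1))) := by
    intro n
    set s : ℝ := 1 / ((n : ℝ) + 1) with hs
    have hsn : s * (n + 1) = 1 := by rw [hs]; field_simp
    have hsY : MemLp (s • Y) (ENNReal.ofReal q) μ := hY.const_smul s
    have hns : 2 * (q - 1) * lpNorm (s • Y) (ENNReal.ofReal q) μ ^ 2 = 2 * (s ^ 2 * C) := by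
      rw [lpNorm_const_smul, mul_pow, coe_nnnorm, Real.norm_eq_abs, sq_abs, hC]; ring
    have h := le_add_of_second_difference_le
      (a := fun k : ℕ => lpNorm (X + (k * s) • Y) (ENNReal.ofReal q) μ ^ 2) (c := s ^ 2 * C)
      ?_ ?_ (n + 1)
    · push_cast at h
      rw [mul_comm _ s, hsn, one_smul, zero_mul, zero_smul, add_zero] at h
      refine h.trans (le_of_eq ?_)
      congr 1
      calc _ = C * (s * (n + 1)) * (s * (n + 1) + s) := by ring
        _ = _ := by rw [hsn]; ring
    · have h1 := lpNorm_smoothness hq hX hsY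
      have h2 := lpNorm_le_lpNorm_sub_of_indepFun hp hXm (hYm.const_smul s) hX hsY
        (hXY.comp measurable_id (measurable_const_smul s))
        (by simp [integral_const_mul, hY0])
      have h3 := pow_le_pow_left₀ lpNorm_nonneg h2 2
      simp only [Nat.cast_one, one_mul, Nat.cast_zero, zero_mul, zero_smul, add_zero]
      linarith
    · intro k
      have h1 := lpNorm_smoothness hq (hX.add (hY.const_smul ((k + 1 : ℕ) * s))) hsY
      have e1 : X + ((k + 1 : ℕ) * s) • Y + s • Y = X + ((k + 2 : ℕ) * s) • Y := by
        push_cast; module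
      have e2 : X + ((k + 1 : ℕ) * s) • Y - s • Y = X + (k * s) • Y := by
        push_cast; module
      rw [e1, e2] at h1
      linarith
  have lim : Tendsto (fun n : ℕ => lpNorm X (ENNReal.ofReal q) μ ^ 2 +
      (C + C * (1 / ((n : ℝ) + 1)))) atTop
      (nhds (lpNorm X (ENNReal.ofReal q) μ ^ 2 + (C + C * 0))) :=
    ((tendsto_one_div_add_atTop_nhds_zero_nat.const_mul C).const_add C).const_add _
  simpa using ge_of_tendsto' lim bound

/-- Rio's moment inequality, for independent centered summands. -/
theorem lpNorm_sum_sq_le_of_iIndepFun {Ω ι : Type*} {m : MeasurableSpace Ω} {μ : Measure Ω}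
    [IsProbabilityMeasure μ] {q : ℝ} (hq : 2 ≤ q) {X : ι → Ω → ℝ}
    (hXm : ∀ i, Measurable (X i)) (hX : ∀ i, MemLp (X i) (ENNReal.ofReal q) μ)
    (hind : iIndepFun X μ) (hX0 : ∀ i, ∫ ω, X i ω ∂μ = 0) (s : Finset ι) :
    lpNorm (∑ i ∈ s, X i) (ENNReal.ofReal q) μ ^ 2 ≤
      (q - 1) * ∑ i ∈ s, lpNorm (X i) (ENNReal.ofReal q) μ ^ 2 := by
  classical
  induction s using Finset.induction_on with
  | empty => simp
  | insert i s hi ih =>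
    rw [Finset.sum_insert hi, Finset.sum_insert hi, add_comm (X i)]
    have hsm : Measurable (∑ i ∈ s, X i) := by fun_prop
    have h := lpNorm_add_sq_le_of_indepFun hq hsm (hXm i)
      (memLp_finsetSum' s fun i _ => hX i) (hX i)
      (hind.indepFun_finsetSum_of_notMem hXm hi) (hX0 i)
    linarith

theorem Matrix.PosSemidef.exists_orthogonal_diagonalization {n : Type*} [Fintype n] [DecidableEq n]
    {S : Matrix n n ℝ} (hS : S.PosSemidef) :
    ∃ (U : Matrix n n ℝ) (d : n → ℝ), (∀ i, 0 ≤ d i) ∧ U.transpose * U = 1 ∧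
      U * U.transpose = 1 ∧ S = U * Matrix.diagonal d * U.transpose := by
  refine ⟨hS.1.eigenvectorUnitary, hS.1.eigenvalues, hS.eigenvalues_nonneg, ?_, ?_, ?_⟩
  · exact Unitary.coe_star_mul_self hS.1.eigenvectorUnitary
  · exact Unitary.coe_mul_star_self hS.1.eigenvectorUnitary
  · have h := hS.1.spectral_theorem
    rw [Unitary.conjStarAlgAut_apply] at h
    exact h

theorem map_sum_eq_gaussianReal {Ω : Type*} [MeasureSpace Ω] {p : ℕ}
    {S U : Matrix (Fin p) (Fin p) ℝ} {d : Fin p → ℝ} {Y : Ω → Fin p → ℝ} (hY : IsGaussianVec Y S)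
    (hU : U.transpose * U = 1) (hSU : S = U * Matrix.diagonal d * U.transpose) (v : Fin p → ℝ) :
    Measure.map (fun ω => ∑ i, v i * ∑ k, U k i * Y ω k) volume =
      gaussianReal 0 (Real.toNNReal (∑ i, v i ^ 2 * d i)) := by
  have hf : (fun ω => ∑ i, v i * ∑ k, U k i * Y ω k) =
      fun ω => ∑ k, U.mulVec v k * Y ω k := by
    funext ω
    simp only [Matrix.mulVec, dotProduct, Finset.mul_sum, Finset.sum_mul]
    rw [Finset.sum_comm]
    exact Finset.sum_congr rfl fun k _ => Finset.sum_congr rfl fun i _ => by ring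
  have hq : ∑ j, ∑ k, U.mulVec v j * S j k * U.mulVec v k = ∑ i, v i ^ 2 * d i := by
    have h1 : ∑ j, ∑ k, U.mulVec v j * S j k * U.mulVec v k
        = dotProduct (U.mulVec v) (S.mulVec (U.mulVec v)) := by
      simp only [Matrix.mulVec, dotProduct, Finset.mul_sum, mul_assoc]
    rw [h1, hSU, Matrix.mulVec_mulVec, Matrix.mul_assoc _ U.transpose, hU, Matrix.mul_one,
      ← Matrix.mulVec_mulVec, Matrix.dotProduct_mulVec, ← Matrix.mulVec_transpose,
      Matrix.mulVec_mulVec, hU, Matrix.one_mulVec]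
    simp only [dotProduct, Matrix.mulVec_diagonal]
    exact Finset.sum_congr rfl fun i _ => by ring
  rw [hf, hY, hq]

theorem iIndepFun_of_map_sum_eq_gaussianReal {Ω ι : Type*} {m : MeasurableSpace Ω} {μ : Measure Ω}
    [IsProbabilityMeasure μ] [Fintype ι] {Z : ι → Ω → ℝ} (hZm : ∀ i, Measurable (Z i))
    {d : ι → ℝ} (hd : ∀ i, 0 ≤ d i)
    (hZ : ∀ v : ι → ℝ, Measure.map (fun ω => ∑ i, v i * Z i ω) μ =
      gaussianReal 0 (Real.toNNReal (∑ i, v i ^ 2 * d i))) :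
    iIndepFun Z μ := by
  classical
  have hm : Measurable (fun ω i => Z i ω) := measurable_pi_lambda _ hZm
  have hlaw : HasGaussianLaw (fun ω => (Z · ω)) μ := by
    refine ⟨isGaussian_of_map_eq_gaussianReal fun L =>
      ⟨0, Real.toNNReal (∑ i, L (Pi.single i 1) ^ 2 * d i), ?_⟩⟩
    rw [Measure.map_map L.continuous.measurable hm, ← hZ fun i => L (Pi.single i 1)]
    congr 1
    funext ω
    simp only [Function.comp_apply]
    conv_lhs => rw [← Finset.univ_sum_single (fun i => Z i ω)]
    rw [map_sum]
    refine Finset.sum_congr rfl fun i _ => ?_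
    rw [mul_comm, ← smul_eq_mul, ← map_smul, ← Pi.single_smul', smul_eq_mul, mul_one]
  have hvar : ∀ v : ι → ℝ, Var[fun ω => ∑ i, v i * Z i ω; μ] = ∑ i, v i ^ 2 * d i := by
    intro v
    have h : Var[id; Measure.map (fun ω => ∑ i, v i * Z i ω) μ] = ∑ i, v i ^ 2 * d i := by
      rw [hZ, variance_id_gaussianReal, Real.coe_toNNReal]
      exact Finset.sum_nonneg fun i _ => mul_nonneg (sq_nonneg _) (hd i)
    rw [← h, variance_map aemeasurable_id (by fun_prop)]
    rfl
  refine hlaw.iIndepFun_of_covariance_eq_zero fun i j hij => ?_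
  have hi : MemLp (Z i) 2 μ := (hlaw.eval i).memLp_two
  have hj : MemLp (Z j) 2 μ := (hlaw.eval j).memLp_two
  have hadd := variance_add hi hj
  have vi := hvar (Pi.single i 1)
  have vj := hvar (Pi.single j 1)
  have vij := hvar (Pi.single i 1 + Pi.single j 1)
  have sum_single : ∀ k, (fun ω => ∑ l, (Pi.single k 1 : ι → ℝ) l * Z l ω) = Z k := by
    intro k
    funext ω
    simp [Pi.single_apply]
  have sum_add : (fun ω => ∑ l, (Pi.single i 1 + Pi.single j 1 : ι → ℝ) l * Z l ω) = Z i + Z j := by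
    funext ω
    simp [Pi.single_apply, add_mul, Finset.sum_add_distrib]
  have sq_add : ∑ l, (Pi.single i 1 + Pi.single j 1 : ι → ℝ) l ^ 2 * d l =
      ∑ l, (Pi.single i 1 : ι → ℝ) l ^ 2 * d l + ∑ l, (Pi.single j 1 : ι → ℝ) l ^ 2 * d l := by
    rw [← Finset.sum_add_distrib]
    refine Finset.sum_congr rfl fun l _ => ?_
    have : (Pi.single i 1 : ι → ℝ) l * (Pi.single j 1 : ι → ℝ) l = 0 := by
      simp only [Pi.single_apply]
      split_ifs with h1 h2 <;> simp_all
    simp only [Pi.add_apply]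
    linear_combination 2 * d l * this
  rw [sum_single] at vi vj
  rw [sum_add, sq_add] at vij
  linarith

theorem gaussianReal_eq_map_sqrt_mul {d : ℝ} (hd : 0 ≤ d) :
    gaussianReal 0 d.toNNReal = (gaussianReal 0 1).map (Real.sqrt d * ·) := by
  rw [gaussianReal_map_const_mul, mul_zero, mul_one]
  congr 1
  ext
  simp [hd]

theorem memLp_sq_sub_one_gaussianReal {q : ℝ} (hq : 0 < q) :
    MemLp (fun x : ℝ => x ^ 2 - 1) (ENNReal.ofReal q) (gaussianReal 0 1) := by
  have h := memLp_sq_half (q := 2 * q) (by positivity)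
    (memLp_id_gaussianReal' (μ := 0) (v := 1) (ENNReal.ofReal (2 * q)) ENNReal.ofReal_ne_top)
  rw [mul_div_cancel_left₀ q two_ne_zero] at h
  exact h.sub (memLp_const 1)

theorem integral_sq_sub_one_gaussianReal : ∫ x : ℝ, (x ^ 2 - 1) ∂gaussianReal 0 1 = 0 := by
  have hint : Integrable (fun x : ℝ => x ^ 2) (gaussianReal 0 1) :=
    (memLp_id_gaussianReal' (μ := 0) (v := 1) 2 (by simp)).integrable_sq
  have hvar := variance_eq_integral (μ := gaussianReal 0 1) (X := fun x : ℝ => x) aemeasurable_id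
  rw [variance_fun_id_gaussianReal, integral_id_gaussianReal] at hvar
  rw [integral_sub hint (integrable_const 1)]
  simp only [sub_zero] at hvar
  rw [← hvar]
  simp

section CenteredSquare

variable {Ω : Type*} {m : MeasurableSpace Ω} {μ : Measure Ω} {Z : Ω → ℝ} {d : ℝ}

theorem map_sq_sub_eq (hd : 0 ≤ d) (hZm : Measurable Z)
    (hZ : μ.map Z = gaussianReal 0 d.toNNReal) :
    μ.map (fun ω => Z ω ^ 2 - d) = (gaussianReal 0 1).map (fun x => d * (x ^ 2 - 1)) := by
  have h : (fun ω => Z ω ^ 2 - d) = (fun x : ℝ => x ^ 2 - d) ∘ Z := rfl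
  rw [h, ← Measure.map_map (by fun_prop) hZm, hZ, gaussianReal_eq_map_sqrt_mul hd,
    Measure.map_map (by fun_prop) (by fun_prop)]
  congr 1
  funext x
  simp only [Function.comp_apply, mul_pow, Real.sq_sqrt hd]
  ring

theorem memLp_sq_sub (hd : 0 ≤ d) (hZm : Measurable Z)
    (hZ : μ.map Z = gaussianReal 0 d.toNNReal) {q : ℝ} (hq : 0 < q) :
    MemLp (fun ω => Z ω ^ 2 - d) (ENNReal.ofReal q) μ := by
  have h := (memLp_sq_sub_one_gaussianReal hq).const_mul d
  rw [← Function.id_comp (fun ω => Z ω ^ 2 - d),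
    ← memLp_map_measure_iff (by fun_prop) (by fun_prop), map_sq_sub_eq hd hZm hZ,
    memLp_map_measure_iff (by fun_prop) (by fun_prop)]
  exact h

theorem integral_sq_sub (hd : 0 ≤ d) (hZm : Measurable Z)
    (hZ : μ.map Z = gaussianReal 0 d.toNNReal) : ∫ ω, (Z ω ^ 2 - d) ∂μ = 0 := by
  have h := integral_map (μ := μ) (φ := fun ω => Z ω ^ 2 - d) (f := fun x : ℝ => x) (by fun_prop)
    (by fun_prop)
  rw [← h, map_sq_sub_eq hd hZm hZ, integral_map (by fun_prop) (by fun_prop), integral_const_mul,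
    integral_sq_sub_one_gaussianReal, mul_zero]

theorem lpNorm_sq_sub (hd : 0 ≤ d) (hZm : Measurable Z)
    (hZ : μ.map Z = gaussianReal 0 d.toNNReal) (p : ENNReal) :
    lpNorm (fun ω => Z ω ^ 2 - d) p μ =
      d * lpNorm (fun x : ℝ => x ^ 2 - 1) p (gaussianReal 0 1) := by
  have h := eLpNorm_map_measure (μ := μ) (f := fun ω => Z ω ^ 2 - d) (g := id) (p := p)
    (by fun_prop) (by fun_prop)
  rw [map_sq_sub_eq hd hZm hZ, eLpNorm_map_measure (by fun_prop) (by fun_prop)] at h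
  have h2 := lpNorm_const_smul (p := p) d (fun x : ℝ => x ^ 2 - 1) (gaussianReal 0 1)
  rw [coe_nnnorm, Real.norm_of_nonneg hd] at h2
  rw [← h2, ← toReal_eLpNorm (by fun_prop), ← toReal_eLpNorm (by fun_prop)]
  exact congrArg ENNReal.toReal h.symm

end CenteredSquare

/-- Proposition 1 (first part): if `Y ~ N(0,Σ)` and `δ ≥ 0`, then
`E|(YᵀY − f₁)/f|^{2+δ} ≤ c_δ^{2+δ}`, where `f₁ = tr Σ`, `f = (tr Σ²)^{1/2}`. -/
theorem gaussian_quadratic_moment_bound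
    {Ω : Type*} [MeasureSpace Ω] [IsProbabilityMeasure (volume : Measure Ω)]
    {p : ℕ} (S : Matrix (Fin p) (Fin p) ℝ) (hS : S.PosSemidef)
    (Y : Ω → Fin p → ℝ) (hYmeas : Measurable Y) (hY : IsGaussianVec Y S)
    (δ : ℝ) (hδ : 0 ≤ δ) :
    (∫ ω, |(∑ j, (Y ω j) ^ 2 - Matrix.trace S) /
        Real.sqrt (Matrix.trace (S * S))| ^ (2 + δ))
      ≤ (cdel δ) ^ (2 + δ) := by
  have hq : 2 ≤ 2 + δ := by linarith
  have hq0 : 0 < 2 + δ := by linarith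
  have hc0 : 0 ≤ cdel δ := mul_nonneg (Real.sqrt_nonneg _)
    (Real.rpow_nonneg (integral_nonneg fun x => Real.rpow_nonneg (abs_nonneg _) _) _)
  obtain ⟨U, d, hd, hU, hU', hSU⟩ := hS.exists_orthogonal_diagonalization
  set Z : Fin p → Ω → ℝ := fun i ω => ∑ k, U k i * Y ω k with hZdef
  have hZm : ∀ i, Measurable (Z i) := fun i => by
    simp only [hZdef]
    fun_prop
  have hZ := map_sum_eq_gaussianReal hY hU hSU
  have hind : iIndepFun Z := iIndepFun_of_map_sum_eq_gaussianReal hZm hd hZ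
  have hZi : ∀ i, Measure.map (Z i) volume = gaussianReal 0 (d i).toNNReal := by
    intro i
    have h := hZ (Pi.single i 1)
    simpa [Pi.single_apply, hZdef] using h
  have htr : Matrix.trace S = ∑ i, d i := by
    rw [hSU, Matrix.trace_mul_comm, ← Matrix.mul_assoc, hU, Matrix.one_mul, Matrix.trace_diagonal]
  have htr2 : Matrix.trace (S * S) = ∑ i, d i ^ 2 := by
    have h : S * S = U * Matrix.diagonal (fun i => d i ^ 2) * U.transpose := by
      rw [hSU]
      calc _ = U * Matrix.diagonal d * (U.transpose * U) * Matrix.diagonal d * U.transpose := by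
            simp only [Matrix.mul_assoc]
        _ = _ := by
            rw [hU, Matrix.mul_one, Matrix.mul_assoc U, Matrix.diagonal_mul_diagonal]
            simp only [sq]
    rw [h, Matrix.trace_mul_comm, ← Matrix.mul_assoc, hU, Matrix.one_mul, Matrix.trace_diagonal]
  have hsum : ∀ ω, ∑ j, (Y ω j) ^ 2 - Matrix.trace S = (∑ i, fun ω => Z i ω ^ 2 - d i) ω := by
    intro ω
    have h : ∑ i, Z i ω ^ 2 = ∑ j, (Y ω j) ^ 2 := by
      have e : ∑ i, Z i ω ^ 2 =
          dotProduct (U.transpose.mulVec (Y ω)) (U.transpose.mulVec (Y ω)) := by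
        simp only [hZdef, dotProduct, Matrix.mulVec, Matrix.transpose_apply, sq]
      rw [e, Matrix.dotProduct_mulVec, ← Matrix.mulVec_transpose, Matrix.transpose_transpose,
        Matrix.mulVec_mulVec, hU', Matrix.one_mulVec]
      simp only [dotProduct, sq]
    rw [Finset.sum_apply, Finset.sum_sub_distrib, h, htr]
  set T : Ω → ℝ := ∑ i, fun ω => Z i ω ^ 2 - d i with hT
  have hTm : Measurable T := by fun_prop
  have hrio := lpNorm_sum_sq_le_of_iIndepFun hq (X := fun i ω => Z i ω ^ 2 - d i)
    (fun i => ((hZm i).pow_const 2).sub_const _)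
    (fun i => memLp_sq_sub (hd i) (hZm i) (hZi i) hq0)
    (hind.comp (fun i x => x ^ 2 - d i) fun i => by fun_prop)
    (fun i => integral_sq_sub (hd i) (hZm i) (hZi i)) Finset.univ
  simp only [lpNorm_sq_sub (hd _) (hZm _) (hZi _), mul_pow, ← Finset.sum_mul, ← htr2] at hrio
  set f : ℝ := Real.sqrt (Matrix.trace (S * S)) with hf
  have hf2 : Matrix.trace (S * S) = f ^ 2 := by
    rw [hf, Real.sq_sqrt]
    rw [htr2]
    exact Finset.sum_nonneg fun i _ => sq_nonneg _
  have hf0 : 0 ≤ f := Real.sqrt_nonneg _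
  clear_value f
  have hcdel : cdel δ = Real.sqrt (1 + δ) *
      lpNorm (fun x : ℝ => x ^ 2 - 1) (ENNReal.ofReal (2 + δ)) (gaussianReal 0 1) := by
    rw [cdel, lpNorm_ofReal_eq hq0 (by fun_prop)]
  have hle : lpNorm T (ENNReal.ofReal (2 + δ)) volume ≤ f * cdel δ := by
    refine abs_le_of_sq_le_sq' ?_ (mul_nonneg hf0 hc0) |>.2
    refine hrio.trans (le_of_eq ?_)
    rw [hf2, hcdel, mul_pow, mul_pow, Real.sq_sqrt (show 0 ≤ 1 + δ by linarith)]
    ring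
  rcases hf0.eq_or_lt with h0 | hpos
  · simp only [← h0, div_zero, abs_zero, Real.zero_rpow hq0.ne', integral_zero]
    exact Real.rpow_nonneg hc0 _
  · have hTn : 0 ≤ ∫ ω, |T ω| ^ (2 + δ) :=
      integral_nonneg fun ω => Real.rpow_nonneg (abs_nonneg _) _
    have hT2 : ∫ ω, |T ω| ^ (2 + δ) ≤ f ^ (2 + δ) * cdel δ ^ (2 + δ) := by
      rw [lpNorm_ofReal_eq hq0 hTm.aestronglyMeasurable] at hle
      have h := Real.rpow_le_rpow (Real.rpow_nonneg hTn _) hle hq0.le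
      rwa [Real.rpow_inv_rpow hTn hq0.ne', Real.mul_rpow hpos.le hc0] at h
    simp only [hsum, abs_div, abs_of_pos hpos, Real.div_rpow (abs_nonneg _) hpos.le]
    rw [integral_div, div_le_iff₀ (Real.rpow_pos_of_pos hpos _), mul_comm]
    exact hT2
end
end

section
/- Let Y₁, Y₂ be i.i.d. N(0,Σ) p-dimensional Gaussian vectors with covariance matrix Σ and let δ ≥ 0. Then E|Y₁ᵀY₂/f|^{2+δ} ≤ d_δ^{2+δ}, where d_δ = (1+δ)^{1/2}‖ξ‖²_{2+δ} and ξ ~ N(0,1). -/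
open MeasureTheory ProbabilityTheory Filter Asymptotics

noncomputable section

/-- `d_δ = (1+δ)^{1/2} ‖ξ‖²_{2+δ}` where `ξ ~ N(0,1)`. -/
def ddel (δ : ℝ) : ℝ :=
  Real.sqrt (1 + δ) * ((∫ x, |x| ^ (2 + δ) ∂(gaussianReal 0 1)) ^ (2 + δ)⁻¹) ^ 2

/-- The `q`-th absolute moment of `N(0, s)` is `s ^ (q / 2)` times that of `N(0, 1)`. -/
lemma lintegral_abs_rpow_gaussianReal (s q : ℝ) (hs : 0 ≤ s) :
    ∫⁻ x, ENNReal.ofReal (|x| ^ q) ∂(gaussianReal 0 s.toNNReal)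
      = ENNReal.ofReal (s ^ (q / 2)) * ∫⁻ x, ENNReal.ofReal (|x| ^ q) ∂(gaussianReal 0 1) := by
  have hmap : gaussianReal 0 s.toNNReal = (gaussianReal 0 1).map (Real.sqrt s * ·) := by
    rw [gaussianReal_map_const_mul]
    congr 1
    · simp
    · ext
      simp [Real.sq_sqrt hs, hs]
  rw [hmap, lintegral_map (by fun_prop) (by fun_prop), ← lintegral_const_mul _ (by fun_prop)]
  refine lintegral_congr fun x => ?_
  rw [← ENNReal.ofReal_mul (by positivity), abs_mul, abs_of_nonneg (Real.sqrt_nonneg s),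
    Real.mul_rpow (Real.sqrt_nonneg s) (abs_nonneg x), Real.sqrt_eq_rpow, ← Real.rpow_mul hs]
  ring_nf

/-- Absolute moments of the standard Gaussian are finite. -/
lemma integrable_abs_rpow_gaussianReal (q : ℝ) (hq : 0 < q) :
    Integrable (fun x : ℝ => |x| ^ q) (gaussianReal 0 1) := by
  have h := (memLp_id_gaussianReal (μ := 0) (v := 1) q.toNNReal).integrable_norm_rpow
    (by simpa using hq) (by simp)
  simpa [hq.le] using h

/-- A positive semidefinite real matrix diagonalizes in an orthonormal basis, expressed through
its quadratic form and the trace of its square. -/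
lemma Matrix.PosSemidef.exists_diagonalization {p : ℕ} {S : Matrix (Fin p) (Fin p) ℝ}
    (hS : S.PosSemidef) :
    ∃ (l : Fin p → ℝ) (v : Fin p → Fin p → ℝ), (∀ j, 0 ≤ l j) ∧
      (∀ j, ∑ i, ∑ k, v j i * S i k * v j k = l j) ∧
      (∀ y : Fin p → ℝ, ∑ i, ∑ k, y i * S i k * y k = ∑ j, l j * (∑ i, v j i * y i) ^ 2) ∧
      Matrix.trace (S * S) = ∑ j, l j ^ 2 := by
  set U : Matrix (Fin p) (Fin p) ℝ := hS.1.eigenvectorUnitary.1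
  set l := hS.1.eigenvalues
  have hUU : star U * U = 1 := Unitary.coe_star_mul_self hS.1.eigenvectorUnitary
  have hspec : S = U * Matrix.diagonal l * star U := by
    simpa [Unitary.conjStarAlgAut_apply] using hS.1.spectral_theorem
  have horth (m j : Fin p) : ∑ i, U i m * U i j = if m = j then 1 else 0 := by
    have := congrFun (congrFun hUU m) j
    simpa [Matrix.mul_apply, Matrix.one_apply, Matrix.star_apply] using this
  have hentry (i k : Fin p) : S i k = ∑ j, U i j * l j * U k j := by
    conv_lhs => rw [hspec]
    simp [Matrix.mul_apply, Matrix.star_apply, Matrix.diagonal_apply]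
  have hquad (y : Fin p → ℝ) :
      ∑ i, ∑ k, y i * S i k * y k = ∑ j, l j * (∑ i, U i j * y i) ^ 2 := by
    simp only [hentry, pow_two, Finset.mul_sum, Finset.sum_mul]
    rw [Finset.sum_comm_cycle]
    refine Finset.sum_congr rfl fun j _ => Finset.sum_congr rfl fun i _ =>
      Finset.sum_congr rfl fun k _ => ?_
    ring
  refine ⟨l, fun j i => U i j, fun j => hS.eigenvalues_nonneg j, fun j => ?_, hquad, ?_⟩
  · rw [hquad]
    simp [horth]
  · have : S * S = U * (Matrix.diagonal l * Matrix.diagonal l) * star U := by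
      conv_lhs => rw [hspec]
      calc _ = U * Matrix.diagonal l * (star U * U) * Matrix.diagonal l * star U := by
            simp only [mul_assoc]
        _ = _ := by rw [hUU]; simp only [mul_assoc, mul_one]
    rw [this, Matrix.trace_mul_cycle, hUU, one_mul, Matrix.diagonal_mul_diagonal,
      Matrix.trace_diagonal]
    simp [pow_two]

/-- Jensen's inequality for the weights `l j ^ 2 / F`. -/
lemma sum_mul_sq_rpow_le {ι : Type*} [Fintype ι] (l x : ι → ℝ) (hl : ∀ j, 0 ≤ l j)
    {F : ℝ} (hF : 0 < F) (hsum : ∑ j, l j ^ 2 = F) {q : ℝ} (hq : 2 ≤ q) :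
    (∑ j, l j * x j ^ 2) ^ (q / 2)
      ≤ ∑ j, F ^ (q / 2) * (l j ^ 2 / F) * (l j ^ (q / 2))⁻¹ * |x j| ^ q := by
  have hterm (j : ι) : l j * x j ^ 2 = F * (l j ^ 2 / F * (x j ^ 2 / l j)) := by
    rcases (hl j).eq_or_lt with h | h
    · simp [← h]
    · field_simp
  have hz (j : ι) : 0 ≤ x j ^ 2 / l j := div_nonneg (sq_nonneg _) (hl j)
  have hpow (j : ι) : (x j ^ 2 / l j) ^ (q / 2) = (l j ^ (q / 2))⁻¹ * |x j| ^ q := by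
    rw [Real.div_rpow (sq_nonneg _) (hl j), ← sq_abs, ← Real.rpow_natCast,
      ← Real.rpow_mul (abs_nonneg _), div_eq_inv_mul]
    congr 2
    push_cast
    ring
  have hJ := Real.rpow_arith_mean_le_arith_mean_rpow Finset.univ (fun j => l j ^ 2 / F)
    (fun j => x j ^ 2 / l j) (fun j _ => by positivity)
    (by rw [← Finset.sum_div, hsum, div_self hF.ne']) (fun j _ => hz j)
    (p := q / 2) (by linarith)
  calc (∑ j, l j * x j ^ 2) ^ (q / 2)
      = F ^ (q / 2) * (∑ j, l j ^ 2 / F * (x j ^ 2 / l j)) ^ (q / 2) := by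
        rw [Finset.sum_congr rfl fun j _ => hterm j, ← Finset.mul_sum, Real.mul_rpow hF.le
          (Finset.sum_nonneg fun j _ => mul_nonneg (by positivity) (hz j))]
    _ ≤ F ^ (q / 2) * ∑ j, l j ^ 2 / F * (x j ^ 2 / l j) ^ (q / 2) := by gcongr
    _ = _ := by
        rw [Finset.mul_sum]
        refine Finset.sum_congr rfl fun j _ => ?_
        rw [hpow]
        ring

/-- A linear functional of a Gaussian vector has the moments of the corresponding real Gaussian. -/
lemma IsGaussianVec.lintegral_abs_rpow {Ω : Type*} [MeasureSpace Ω] {p : ℕ}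
    {Y : Ω → Fin p → ℝ} {S : Matrix (Fin p) (Fin p) ℝ} (hY : IsGaussianVec Y S)
    (hm : Measurable Y) (u : Fin p → ℝ) (hu : 0 ≤ ∑ j, ∑ k, u j * S j k * u k)
    (q : ℝ) :
    ∫⁻ ω, ENNReal.ofReal (|∑ j, u j * Y ω j| ^ q)
      = ENNReal.ofReal ((∑ j, ∑ k, u j * S j k * u k) ^ (q / 2))
        * ∫⁻ x, ENNReal.ofReal (|x| ^ q) ∂(gaussianReal 0 1) := by
  rw [← lintegral_abs_rpow_gaussianReal _ _ hu, ← hY u,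
    lintegral_map (by fun_prop) (by fun_prop)]

/-- Moments of the quadratic form `Yᵀ S Y` of a Gaussian vector `Y ~ N(0, S)`. -/
lemma IsGaussianVec.lintegral_quadratic_rpow_le {Ω : Type*} [MeasureSpace Ω] {p : ℕ}
    {Y : Ω → Fin p → ℝ} {S : Matrix (Fin p) (Fin p) ℝ} (hY : IsGaussianVec Y S)
    (hm : Measurable Y) (hS : S.PosSemidef) (hF : 0 < Matrix.trace (S * S))
    {q : ℝ} (hq : 2 ≤ q) :
    ∫⁻ ω, ENNReal.ofReal ((∑ j, ∑ k, Y ω j * S j k * Y ω k) ^ (q / 2))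
      ≤ ENNReal.ofReal (Matrix.trace (S * S) ^ (q / 2))
        * ∫⁻ x, ENNReal.ofReal (|x| ^ q) ∂(gaussianReal 0 1) := by
  obtain ⟨l, v, hl, hv, hquad, htr⟩ := hS.exists_diagonalization
  set F := Matrix.trace (S * S)
  set M := ∫⁻ x, ENNReal.ofReal (|x| ^ q) ∂(gaussianReal 0 1)
  have hc (j : Fin p) : 0 ≤ F ^ (q / 2) * (l j ^ 2 / F) * (l j ^ (q / 2))⁻¹ := by
    have := Real.rpow_nonneg (hl j) (q / 2)
    positivity
  calc ∫⁻ ω, ENNReal.ofReal ((∑ j, ∑ k, Y ω j * S j k * Y ω k) ^ (q / 2))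
      ≤ ∫⁻ ω, ∑ j, ENNReal.ofReal (F ^ (q / 2) * (l j ^ 2 / F) * (l j ^ (q / 2))⁻¹)
          * ENNReal.ofReal (|∑ i, v j i * Y ω i| ^ q) := by
        refine lintegral_mono fun ω => ?_
        simp only [← ENNReal.ofReal_mul (hc _)]
        rw [← ENNReal.ofReal_sum_of_nonneg fun j _ => mul_nonneg (hc j) (by positivity), hquad]
        exact ENNReal.ofReal_le_ofReal (sum_mul_sq_rpow_le l _ hl hF htr.symm hq)
    _ = ∑ j, ENNReal.ofReal (F ^ (q / 2) * (l j ^ 2 / F)) * M := by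
        rw [lintegral_finsetSum _ fun j _ => by fun_prop]
        refine Finset.sum_congr rfl fun j _ => ?_
        rw [lintegral_const_mul _ (by fun_prop),
          hY.lintegral_abs_rpow hm (v j) (by rw [hv]; exact hl j) q, hv,
          ← mul_assoc, ← ENNReal.ofReal_mul (hc j)]
        congr 2
        rcases (hl j).eq_or_lt with h | h
        · simp [← h]
        · rw [inv_mul_cancel_right₀ (Real.rpow_pos_of_pos h _).ne']
    _ = ENNReal.ofReal (F ^ (q / 2)) * M := by
        rw [← Finset.sum_mul, ← ENNReal.ofReal_sum_of_nonneg fun j _ => by positivity,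
          ← Finset.mul_sum, ← Finset.sum_div, ← htr, div_self hF.ne', mul_one]

/-- Proposition 1 (second part): if `Y₁, Y₂` are i.i.d. `N(0,Σ)` and `δ ≥ 0`, then
`E|Y₁ᵀY₂/f|^{2+δ} ≤ d_δ^{2+δ}`, where `f = (tr Σ²)^{1/2}`. -/
theorem gaussian_bilinear_moment_bound
    {Ω : Type*} [MeasureSpace Ω] [IsProbabilityMeasure (volume : Measure Ω)]
    {p : ℕ} (S : Matrix (Fin p) (Fin p) ℝ) (hS : S.PosSemidef)
    (Y₁ Y₂ : Ω → Fin p → ℝ) (hY1meas : Measurable Y₁) (hY2meas : Measurable Y₂)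
    (hY1 : IsGaussianVec Y₁ S) (hY2 : IsGaussianVec Y₂ S)
    (hindep : IndepFun Y₁ Y₂ volume)
    (δ : ℝ) (hδ : 0 ≤ δ) :
    (∫ ω, |(∑ j, Y₁ ω j * Y₂ ω j) / Real.sqrt (Matrix.trace (S * S))| ^ (2 + δ))
      ≤ (ddel δ) ^ (2 + δ) := by
  have hq0 : 0 < 2 + δ := by linarith
  set q := 2 + δ with hq
  set m := ∫ x, |x| ^ q ∂(gaussianReal 0 1) with hm
  have hm0 : 0 ≤ m := integral_nonneg fun x => by positivity
  have hM : ∫⁻ x, ENNReal.ofReal (|x| ^ q) ∂(gaussianReal 0 1) = ENNReal.ofReal m :=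
    (ofReal_integral_eq_lintegral_ofReal (integrable_abs_rpow_gaussianReal q hq0)
      (ae_of_all _ fun x => by positivity)).symm
  have hd : m ^ 2 ≤ ddel δ ^ q := by
    have hdd : ddel δ = Real.sqrt (1 + δ) * (m ^ q⁻¹) ^ 2 := rfl
    rw [hdd, Real.mul_rpow (Real.sqrt_nonneg _) (by positivity),
      ← Real.rpow_pow_comm (by positivity), Real.rpow_inv_rpow hm0 hq0.ne']
    exact le_mul_of_one_le_left (by positivity)
      (Real.one_le_rpow (Real.one_le_sqrt.2 (by linarith)) hq0.le)
  set F := Matrix.trace (S * S)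
  rcases le_or_gt F 0 with hF | hF
  · simp only [Real.sqrt_eq_zero_of_nonpos hF, div_zero, abs_zero, Real.zero_rpow hq0.ne',
      integral_zero]
    exact (sq_nonneg m).trans hd
  refine le_trans ?_ hd
  have hquad (u : Fin p → ℝ) : 0 ≤ ∑ j, ∑ k, u j * S j k * u k := by
    obtain ⟨l, v, hl, -, h, -⟩ := hS.exists_diagonalization
    rw [h]
    exact Finset.sum_nonneg fun j _ => mul_nonneg (hl j) (sq_nonneg _)
  have hprod : ∫⁻ ω, ENNReal.ofReal (|∑ j, Y₁ ω j * Y₂ ω j| ^ q)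
      = ∫⁻ ω₂, ∫⁻ ω₁, ENNReal.ofReal (|∑ j, Y₂ ω₂ j * Y₁ ω₁ j| ^ q) := by
    have hmap := (indepFun_iff_map_prod_eq_prod_map_map hY2meas.aemeasurable
      hY1meas.aemeasurable).1 hindep.symm
    have hmeas : Measurable fun y : (Fin p → ℝ) × (Fin p → ℝ) =>
        ENNReal.ofReal (|∑ j, y.1 j * y.2 j| ^ q) := by fun_prop
    have : IsProbabilityMeasure (Measure.map Y₁ volume) :=
      Measure.isProbabilityMeasure_map hY1meas.aemeasurable
    calc ∫⁻ ω, ENNReal.ofReal (|∑ j, Y₁ ω j * Y₂ ω j| ^ q)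
        = ∫⁻ ω, ENNReal.ofReal (|∑ j, Y₂ ω j * Y₁ ω j| ^ q) := by simp only [mul_comm]
      _ = ∫⁻ y, ENNReal.ofReal (|∑ j, y.1 j * y.2 j| ^ q)
            ∂(Measure.map (fun ω => (Y₂ ω, Y₁ ω)) volume) :=
          (lintegral_map hmeas (hY2meas.prodMk hY1meas)).symm
      _ = _ := by
          rw [hmap, lintegral_prod _ hmeas.aemeasurable,
            lintegral_map hmeas.lintegral_prod_right' hY2meas]
          refine lintegral_congr fun ω => ?_
          rw [lintegral_map (by fun_prop) hY1meas]
  have hbound : ∫⁻ ω, ENNReal.ofReal (|∑ j, Y₁ ω j * Y₂ ω j| ^ q)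
      ≤ ENNReal.ofReal (F ^ (q / 2) * m ^ 2) := by
    rw [hprod]
    simp only [hY1.lintegral_abs_rpow hY1meas _ (hquad _) q, hM]
    rw [lintegral_mul_const' _ _ ENNReal.ofReal_ne_top, pow_two, ← mul_assoc,
      ENNReal.ofReal_mul (by positivity), ENNReal.ofReal_mul (by positivity), ← hM]
    gcongr
    exact hY2.lintegral_quadratic_rpow_le hY2meas hS hF (by linarith)
  have hscale (ω : Ω) : |(∑ j, Y₁ ω j * Y₂ ω j) / Real.sqrt F| ^ q
      = |∑ j, Y₁ ω j * Y₂ ω j| ^ q / F ^ (q / 2) := by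
    rw [abs_div, abs_of_nonneg (Real.sqrt_nonneg F), Real.div_rpow (abs_nonneg _)
      (Real.sqrt_nonneg F), Real.sqrt_eq_rpow, ← Real.rpow_mul hF.le]
    ring_nf
  simp only [hscale]
  rw [integral_div, div_le_iff₀ (by positivity), mul_comm (m ^ 2),
    integral_eq_lintegral_of_nonneg_ae (ae_of_all _ fun ω => by positivity)
      (by
        have : Measurable fun ω => |∑ j, Y₁ ω j * Y₂ ω j| ^ q := by fun_prop
        exact this.aestronglyMeasurable)]
  exact ENNReal.toReal_le_of_le_ofReal (by positivity) hbound
end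
end

section
/- Let X₁, X₂ be i.i.d. p-dimensional random vectors with mean 0, covariance Σ = (σ_{jk}), and finite fourth moments. Then E[(X₁ᵀX₂)⁴] = 3f⁴ + 6f₄⁴ + 6 Σ_{1≤j,k,m,q≤p} cum(X_{1j},X_{1k},X_{1m},X_{1q}) σ_{km} σ_{qj} + Σ_{1≤j,k,m,q≤p} cum(X_{1j},X_{1k},X_{1m},X_{1q})², where cum denotes the joint fourth-order cumulant. -/
open MeasureTheory ProbabilityTheory Filter Asymptotics

noncomputable section

theorem sum_mul_self_eq_cumulant_expansion {ι : Type*} [Fintype ι]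
    (S : Matrix ι ι ℝ) (M : ι → ι → ι → ι → ℝ) (hS : ∀ j k, S j k = S k j)
    (h₁ : ∀ j k m q, M j k m q = M k j m q) (h₂ : ∀ j k m q, M j k m q = M j m k q) :
    ∑ j, ∑ k, ∑ m, ∑ q, M j k m q * M j k m q
      = 3 * Matrix.trace (S * S) ^ 2 + 6 * Matrix.trace (S * S * S * S)
        + 6 * ∑ j, ∑ k, ∑ m, ∑ q,
            (M j k m q - S j k * S m q - S j m * S k q - S j q * S k m) * S k m * S q j
        + ∑ j, ∑ k, ∑ m, ∑ q,
            (M j k m q - S j k * S m q - S j m * S k q - S j q * S k m) ^ 2 := by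
  have swap₁ (F : ι → ι → ι → ι → ℝ) :
      ∑ j, ∑ k, ∑ m, ∑ q, F j k m q = ∑ j, ∑ k, ∑ m, ∑ q, F k j m q :=
    Finset.sum_comm
  have swap₂ (F : ι → ι → ι → ι → ℝ) :
      ∑ j, ∑ k, ∑ m, ∑ q, F j k m q = ∑ j, ∑ k, ∑ m, ∑ q, F j m k q :=
    Finset.sum_congr rfl fun _ _ => Finset.sum_comm
  have swap₃ (F : ι → ι → ι → ι → ℝ) :
      ∑ j, ∑ k, ∑ m, ∑ q, F j k m q = ∑ j, ∑ k, ∑ m, ∑ q, F j k q m :=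
    Finset.sum_congr rfl fun _ _ => Finset.sum_congr rfl fun _ _ => Finset.sum_comm
  obtain ⟨c, hc⟩ : ∃ c : ι → ι → ι → ι → ℝ, ∀ j k m q,
      c j k m q = M j k m q - S j k * S m q - S j m * S k q - S j q * S k m :=
    ⟨_, fun _ _ _ _ => rfl⟩
  have hM : ∀ j k m q,
      M j k m q = c j k m q + S j k * S m q + S j m * S k q + S j q * S k m := by
    intro j k m q
    rw [hc]
    ring
  have hc₁ : ∀ j k m q, c j k m q = c k j m q := by
    intro j k m q
    rw [hc, hc, h₁ j k, hS j k]
    ring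
  have hc₂ : ∀ j k m q, c j k m q = c j m k q := by
    intro j k m q
    rw [hc, hc, h₂ j k, hS k m]
    ring
  have cA : ∑ j, ∑ k, ∑ m, ∑ q, c j k m q * (S j k * S m q)
      = ∑ j, ∑ k, ∑ m, ∑ q, c j k m q * (S j m * S k q) := by
    rw [swap₂]
    simp_rw [← hc₂]
  have cB : ∑ j, ∑ k, ∑ m, ∑ q, c j k m q * (S j m * S k q)
      = ∑ j, ∑ k, ∑ m, ∑ q, c j k m q * S k m * S q j := by
    rw [swap₁]
    refine Finset.sum_congr rfl fun j _ => Finset.sum_congr rfl fun k _ =>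
      Finset.sum_congr rfl fun m _ => Finset.sum_congr rfl fun q _ => ?_
    rw [hc₁ k j, hS q j]
    ring
  have cC : ∑ j, ∑ k, ∑ m, ∑ q, c j k m q * (S j q * S k m)
      = ∑ j, ∑ k, ∑ m, ∑ q, c j k m q * S k m * S q j := by
    refine Finset.sum_congr rfl fun j _ => Finset.sum_congr rfl fun k _ =>
      Finset.sum_congr rfl fun m _ => Finset.sum_congr rfl fun q _ => ?_
    rw [hS q j]
    ring
  have AA : ∑ j, ∑ k, ∑ m, ∑ q, (S j k * S m q) ^ 2 = Matrix.trace (S * S) ^ 2 := by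
    have htr : Matrix.trace (S * S) = ∑ j, ∑ k, S j k ^ 2 := by
      simp only [Matrix.trace, Matrix.diag, Matrix.mul_apply]
      refine Finset.sum_congr rfl fun j _ => Finset.sum_congr rfl fun k _ => ?_
      rw [hS k j]
      ring
    rw [htr, sq, Finset.sum_mul]
    simp_rw [Finset.sum_mul, Finset.mul_sum, mul_pow]
  have BB : ∑ j, ∑ k, ∑ m, ∑ q, (S j m * S k q) ^ 2 = Matrix.trace (S * S) ^ 2 := by
    rw [swap₂, AA]
  have CC : ∑ j, ∑ k, ∑ m, ∑ q, (S j q * S k m) ^ 2 = Matrix.trace (S * S) ^ 2 := by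
    rw [swap₃, BB]
  have AC : ∑ j, ∑ k, ∑ m, ∑ q, S j k * S m q * (S j q * S k m)
      = Matrix.trace (S * S * S * S) := by
    simp only [Matrix.trace, Matrix.diag, Matrix.mul_apply, Finset.sum_mul]
    refine Finset.sum_congr rfl fun j _ => Finset.sum_congr rfl fun k _ =>
      Finset.sum_congr rfl fun m _ => Finset.sum_congr rfl fun q _ => ?_
    rw [hS j k, hS m q, hS k m]
    ring
  have AB : ∑ j, ∑ k, ∑ m, ∑ q, S j k * S m q * (S j m * S k q)
      = Matrix.trace (S * S * S * S) := by
    rw [swap₃, ← AC]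
    refine Finset.sum_congr rfl fun j _ => Finset.sum_congr rfl fun k _ =>
      Finset.sum_congr rfl fun m _ => Finset.sum_congr rfl fun q _ => ?_
    rw [hS q m]
  have BC : ∑ j, ∑ k, ∑ m, ∑ q, S j m * S k q * (S j q * S k m)
      = Matrix.trace (S * S * S * S) := by
    rw [swap₂, ← AC]
    refine Finset.sum_congr rfl fun j _ => Finset.sum_congr rfl fun k _ =>
      Finset.sum_congr rfl fun m _ => Finset.sum_congr rfl fun q _ => ?_
    rw [hS m k]
  simp_rw [← hc]
  have expand : ∀ j k m q, M j k m q * M j k m q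
      = c j k m q ^ 2 + 2 * (c j k m q * (S j k * S m q)) + 2 * (c j k m q * (S j m * S k q))
        + 2 * (c j k m q * (S j q * S k m)) + (S j k * S m q) ^ 2 + (S j m * S k q) ^ 2
        + (S j q * S k m) ^ 2 + 2 * (S j k * S m q * (S j m * S k q))
        + 2 * (S j k * S m q * (S j q * S k m)) + 2 * (S j m * S k q * (S j q * S k m)) := by
    intro j k m q
    rw [hM]
    ring
  simp_rw [expand, Finset.sum_add_distrib, ← Finset.mul_sum]
  rw [cA, cB, cC, AA, BB, CC, AC, AB, BC]
  ring

theorem abs_mul_four_le_sum_pow_four (a b c d : ℝ) :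
    |a * b * c * d| ≤ a ^ 4 + b ^ 4 + c ^ 4 + d ^ 4 := by
  rw [abs_le]
  constructor <;>
    nlinarith [sq_nonneg (a * b + c * d), sq_nonneg (a * b - c * d), sq_nonneg (a ^ 2 - b ^ 2),
      sq_nonneg (c ^ 2 - d ^ 2), sq_nonneg (a ^ 2), sq_nonneg (b ^ 2), sq_nonneg (c ^ 2),
      sq_nonneg (d ^ 2)]

theorem sum_pow_four_eq_sum {ι R : Type*} [Fintype ι] [CommSemiring R] (f : ι → R) :
    (∑ j, f j) ^ 4 = ∑ j, ∑ k, ∑ m, ∑ q, f j * f k * f m * f q := by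
  simp_rw [mul_assoc, ← Finset.mul_sum, ← Finset.sum_mul]
  ring

theorem integrable_mul_four_of_integrable_pow_four {Ω ι : Type*} [MeasurableSpace Ω]
    {μ : Measure Ω} {X : Ω → ι → ℝ} (hX : Measurable X)
    (h : ∀ j, Integrable (fun ω => X ω j ^ 4) μ) (j k m q : ι) :
    Integrable (fun ω => X ω j * X ω k * X ω m * X ω q) μ := by
  have hm : ∀ j, Measurable fun ω => X ω j := fun j => (measurable_pi_apply j).comp hX
  refine ((((h j).add (h k)).add (h m)).add (h q)).mono'
    ((((hm j).mul (hm k)).mul (hm m)).mul (hm q)).aestronglyMeasurable ?_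
  exact Filter.Eventually.of_forall fun ω =>
    abs_mul_four_le_sum_pow_four (X ω j) (X ω k) (X ω m) (X ω q)

/-- Proposition 3: cumulant expression for `E[(X₁ᵀX₂)⁴]` for i.i.d. mean-zero random
vectors `X₁, X₂` with covariance matrix `Σ` and finite fourth moments:
`E[(X₁ᵀX₂)⁴] = 3f⁴ + 6f₄⁴ + 6 Σ cum(X_{1j},X_{1k},X_{1m},X_{1q}) σ_{km} σ_{qj}
              + Σ cum(X_{1j},X_{1k},X_{1m},X_{1q})²`,
where `f⁴ = (tr Σ²)²`, `f₄⁴ = tr Σ⁴` and, for mean-zero variables,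
`cum(Z₁,Z₂,Z₃,Z₄) = E(Z₁Z₂Z₃Z₄) − E(Z₁Z₂)E(Z₃Z₄) − E(Z₁Z₃)E(Z₂Z₄) − E(Z₁Z₄)E(Z₂Z₃)`. -/
theorem bilinear_fourth_moment_cumulant_expansion
    {Ω : Type*} [MeasureSpace Ω] [IsProbabilityMeasure (volume : Measure Ω)]
    {p : ℕ} (S : Matrix (Fin p) (Fin p) ℝ)
    (X₁ X₂ : Ω → Fin p → ℝ) (hX1meas : Measurable X₁) (hX2meas : Measurable X₂)
    (hindep : IndepFun X₁ X₂ volume)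
    (hident : Measure.map X₂ volume = Measure.map X₁ volume)
    (hmean : ∀ j, ∫ ω, X₁ ω j = 0)
    (hcov : ∀ j k, ∫ ω, X₁ ω j * X₁ ω k = S j k)
    (hmom4 : ∀ j, Integrable (fun ω => (X₁ ω j) ^ 4)) :
    (∫ ω, (∑ j, X₁ ω j * X₂ ω j) ^ 4)
      = 3 * Matrix.trace (S * S) ^ 2 + 6 * Matrix.trace (S * S * S * S)
        + 6 * ∑ j, ∑ k, ∑ m, ∑ q,
            ((∫ ω, X₁ ω j * X₁ ω k * X₁ ω m * X₁ ω q)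
              - S j k * S m q - S j m * S k q - S j q * S k m) * S k m * S q j
        + ∑ j, ∑ k, ∑ m, ∑ q,
            ((∫ ω, X₁ ω j * X₁ ω k * X₁ ω m * X₁ ω q)
              - S j k * S m q - S j m * S k q - S j q * S k m) ^ 2 := by
  have hg : ∀ j k m q : Fin p, Measurable fun x : Fin p → ℝ => x j * x k * x m * x q := by
    intro j k m q
    fun_prop
  have hid : IdentDistrib X₂ X₁ volume volume :=
    ⟨hX2meas.aemeasurable, hX1meas.aemeasurable, hident⟩
  have hmom4' : ∀ j, Integrable fun ω => X₂ ω j ^ 4 := fun j =>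
    (hid.comp (u := fun x : Fin p → ℝ => x j ^ 4) (by fun_prop)).integrable_iff.mpr (hmom4 j)
  have hI₁ := integrable_mul_four_of_integrable_pow_four hX1meas hmom4
  have hI₂ := integrable_mul_four_of_integrable_pow_four hX2meas hmom4'
  have hind : ∀ j k m q, IndepFun (fun ω => X₁ ω j * X₁ ω k * X₁ ω m * X₁ ω q)
      (fun ω => X₂ ω j * X₂ ω k * X₂ ω m * X₂ ω q) volume := fun j k m q =>
    hindep.comp (hg j k m q) (hg j k m q)
  have hsplit : ∀ (ω : Ω) (j k m q : Fin p),
      X₁ ω j * X₂ ω j * (X₁ ω k * X₂ ω k) * (X₁ ω m * X₂ ω m) * (X₁ ω q * X₂ ω q)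
        = X₁ ω j * X₁ ω k * X₁ ω m * X₁ ω q * (X₂ ω j * X₂ ω k * X₂ ω m * X₂ ω q) := by
    intro ω j k m q
    ring
  have hI : ∀ j k m q, Integrable fun ω =>
      X₁ ω j * X₁ ω k * X₁ ω m * X₁ ω q * (X₂ ω j * X₂ ω k * X₂ ω m * X₂ ω q) :=
    fun j k m q => (hind j k m q).integrable_mul (hI₁ j k m q) (hI₂ j k m q)
  have hval : ∀ j k m q,
      ∫ ω, X₁ ω j * X₁ ω k * X₁ ω m * X₁ ω q * (X₂ ω j * X₂ ω k * X₂ ω m * X₂ ω q)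
        = (∫ ω, X₁ ω j * X₁ ω k * X₁ ω m * X₁ ω q)
          * ∫ ω, X₁ ω j * X₁ ω k * X₁ ω m * X₁ ω q := by
    intro j k m q
    have heq : ∫ ω, X₂ ω j * X₂ ω k * X₂ ω m * X₂ ω q
        = ∫ ω, X₁ ω j * X₁ ω k * X₁ ω m * X₁ ω q := (hid.comp (hg j k m q)).integral_eq
    rw [(hind j k m q).integral_fun_mul_eq_mul_integral (hI₁ j k m q).aestronglyMeasurable
      (hI₂ j k m q).aestronglyMeasurable, heq]
  have hLHS : (∫ ω, (∑ j, X₁ ω j * X₂ ω j) ^ 4) = ∑ j, ∑ k, ∑ m, ∑ q,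
      (∫ ω, X₁ ω j * X₁ ω k * X₁ ω m * X₁ ω q)
        * ∫ ω, X₁ ω j * X₁ ω k * X₁ ω m * X₁ ω q := by
    simp_rw [sum_pow_four_eq_sum, hsplit]
    rw [integral_finsetSum _ fun j _ => integrable_finsetSum _ fun k _ =>
      integrable_finsetSum _ fun m _ => integrable_finsetSum _ fun q _ => hI j k m q]
    refine Finset.sum_congr rfl fun j _ => ?_
    rw [integral_finsetSum _ fun k _ => integrable_finsetSum _ fun m _ =>
      integrable_finsetSum _ fun q _ => hI j k m q]
    refine Finset.sum_congr rfl fun k _ => ?_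
    rw [integral_finsetSum _ fun m _ => integrable_finsetSum _ fun q _ => hI j k m q]
    refine Finset.sum_congr rfl fun m _ => ?_
    rw [integral_finsetSum _ fun q _ => hI j k m q]
    exact Finset.sum_congr rfl fun q _ => hval j k m q
  rw [hLHS]
  refine sum_mul_self_eq_cumulant_expansion S
    (fun j k m q => ∫ ω, X₁ ω j * X₁ ω k * X₁ ω m * X₁ ω q) (fun j k => ?_)
    (fun j k m q => ?_) (fun j k m q => ?_)
  · simp_rw [← hcov, mul_comm]
  · exact integral_congr_ae (Filter.Eventually.of_forall fun ω => by ring)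
  · exact integral_congr_ae (Filter.Eventually.of_forall fun ω => by ring)
end
end
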